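/- For every ε > 0 there exists n_0 such that for all n ≥ n_0, every n-vertex (3,4)-tournament contains a directed tight path on at least (1−ε)·(n/3)^{1/5} vertices. -/

import Mathlib

/-- An `(r,k)`-tournament on vertex set `Fin n`: every edge is an injective
`r`-tuple of vertices, and for every `r`-element set of vertices exactly `k`
of its orderings are edges. -/
def IsRKTournament (r k n : ℕ) (E : Set (Fin r → Fin n)) : Prop :=
  (∀ e ∈ E, Function.Injective e) ∧
  ∀ S : Finset (Fin n), S.card = r →
    {e | e ∈ E ∧ ∀ i, e i ∈ S}.ncard = k

/-- `v` is a directed tight path sequence in the `r`-digraph with edge set `E`: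
its entries are distinct and every `r` consecutive entries form an edge. -/
def IsTightPathSeq {r n s : ℕ} (E : Set (Fin r → Fin n)) (v : Fin s → Fin n) : Prop :=
  Function.Injective v ∧
  ∀ j : ℕ, ∀ h : j + r ≤ s,
    (fun i : Fin r => v ⟨j + i.1, by have := i.isLt; omega⟩) ∈ E

/-- The `r`-digraph with edge set `E` contains a directed tight path on `s` vertices. -/
def HasTightPath (r : ℕ) {n : ℕ} (E : Set (Fin r → Fin n)) (s : ℕ) : Prop :=
  ∃ v : Fin s → Fin n, IsTightPathSeq E v

/-- Among the three cyclic shifts of `(a, b, c)`, at least two satisfy `R`. -/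
def TwoCyclic {α : Type*} (R : α → α → α → Prop) (a b c : α) : Prop :=
  (R a b c ∧ R b c a) ∨ (R b c a ∧ R c a b) ∨ (R c a b ∧ R a b c)

/-- A labelling of ordered pairs such that every oriented triangle in `U` has exactly one
descent. -/
def IsCyclicLabelling {α : Type*} (U : Finset α) (f : α → α → ℕ) : Prop :=
  ∀ a ∈ U, ∀ b ∈ U, ∀ c ∈ U, a ≠ b → b ≠ c → c ≠ a →
    TwoCyclic (fun x y z => f x y < f y z) a b c

/-- The first `k` steps of the walk `v` stay in `U` and carry the labels `0, …, k - 1`. -/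
def IsRainbowWalk {α : Type*} (U : Finset α) (f : α → α → ℕ) (k : ℕ) (v : ℕ → α) : Prop :=
  ∀ i < k, v i ∈ U ∧ v (i + 1) ∈ U ∧ v i ≠ v (i + 1) ∧ f (v i) (v (i + 1)) = i

theorem IsCyclicLabelling.mono {α : Type*} {U U' : Finset α} {f : α → α → ℕ}
    (h : IsCyclicLabelling U f) (hU : U' ⊆ U) : IsCyclicLabelling U' f :=
  fun a ha b hb c hc => h a (hU ha) b (hU hb) c (hU hc)

/-- Two walks using every label once cannot be disjoint. -/
theorem IsCyclicLabelling.not_disjoint_walks {α : Type*} {U : Finset α} {f : α → α → ℕ} {k : ℕ}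
    (h : IsCyclicLabelling U f) (hf : ∀ a ∈ U, ∀ b ∈ U, a ≠ b → f a b < k + 1)
    {v w : ℕ → α} (hv : IsRainbowWalk U f (k + 1) v) (hw : IsRainbowWalk U f (k + 1) w)
    (hvw : ∀ i ≤ k + 1, ∀ j ≤ k + 1, v i ≠ w j) : False := by
  have first : ∀ i ≤ k, (f (v i) (v (i + 1)) = i) ∧
      TwoCyclic (fun x y z => f x y < f y z) (v i) (v (i + 1)) (w i) := fun i hi => by
    obtain ⟨h1, h2, h3, h4⟩ := hv i (by omega)
    obtain ⟨g1, -, -, -⟩ := hw i (by omega)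
    exact ⟨h4, h _ h1 _ h2 _ g1 h3 (hvw _ (by omega) _ (by omega))
      (hvw _ (by omega) _ (by omega)).symm⟩
  have second : ∀ i < k, (f (w i) (w (i + 1)) = i) ∧
      TwoCyclic (fun x y z => f x y < f y z) (w i) (w (i + 1)) (v (i + 1)) := fun i hi => by
    obtain ⟨g1, g2, g3, g4⟩ := hw i (by omega)
    obtain ⟨-, h2, -, -⟩ := hv i (by omega)
    exact ⟨g4, h _ g1 _ g2 _ h2 g3 (hvw _ (by omega) _ (by omega)).symm
      (hvw _ (by omega) _ (by omega))⟩
  have key : ∀ d ≤ k, f (w (k - d)) (v (k - d)) < k - d := by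
    intro d
    induction d with
    | zero =>
      intro _
      obtain ⟨h1, h2⟩ := first k le_rfl
      have := hf (v (k + 1)) (hv k (by omega)).2.1 (w k) (hw k (by omega)).1
        (hvw _ (by omega) _ (by omega))
      unfold TwoCyclic at h2
      simp only [Nat.sub_zero]
      omega
    | succ d ih =>
      intro hd
      have ih := ih (by omega)
      obtain ⟨i, rfl⟩ : ∃ i, k = i + (d + 1) := ⟨k - (d + 1), by omega⟩
      have e1 : i + (d + 1) - d = i + 1 := by omega
      have e2 : i + (d + 1) - (d + 1) = i := by omega
      rw [e1] at ih
      rw [e2]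
      obtain ⟨h1, h2⟩ := first i (by omega)
      obtain ⟨g1, g2⟩ := second i (by omega)
      unfold TwoCyclic at h2 g2
      omega
  have := key k le_rfl
  omega

/-- If no walk uses all labels in order, one label can be saved. -/
theorem IsCyclicLabelling.exists_relabel {α : Type*} {U : Finset α} {f : α → α → ℕ} {k : ℕ}
    (h : IsCyclicLabelling U f) (hf : ∀ a ∈ U, ∀ b ∈ U, a ≠ b → f a b < k + 1)
    (hno : ∀ v, ¬ IsRainbowWalk U f (k + 1) v) :
    ∃ g : α → α → ℕ, IsCyclicLabelling U g ∧ ∀ a ∈ U, ∀ b ∈ U, a ≠ b → g a b < k := by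
  classical
  let H : α → α → Prop := fun a b =>
    ∃ v, IsRainbowWalk U f (f a b + 1) v ∧ v (f a b) = a ∧ v (f a b + 1) = b
  have hzero : ∀ a ∈ U, ∀ b ∈ U, a ≠ b → f a b = 0 → H a b := fun a ha b hb hab h0 => by
    refine ⟨fun i => if i = 0 then a else b, fun i hi => ?_, by simp [h0], by simp⟩
    obtain rfl : i = 0 := by omega
    simp [ha, hb, hab, h0]
  have hstep : ∀ a b c, b ∈ U → c ∈ U → b ≠ c → f b c = f a b + 1 → H a b → H b c := by
    rintro a b c hb hc hbc he ⟨v, hv, h1, h2⟩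
    refine ⟨Function.update v (f b c + 1) c, fun i hi => ?_, ?_, by simp⟩
    · rcases Nat.lt_succ_iff_lt_or_eq.1 hi with hi | rfl
      · rw [Function.update_of_ne (by omega), Function.update_of_ne (by omega)]
        exact hv i (by omega)
      · rw [Function.update_of_ne (by omega), Function.update_self, he, h2]
        exact ⟨hb, hc, hbc, he⟩
    · rw [Function.update_of_ne (by omega), he, h2]
  have hlast : ∀ a b, H a b → f a b ≠ k := by
    rintro a b ⟨v, hv, -, -⟩ he
    exact hno v (he ▸ hv)
  let g : α → α → ℕ := fun a b => if H a b then f a b else f a b - 1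
  have hmono : ∀ a ∈ U, ∀ b ∈ U, ∀ c ∈ U, a ≠ b → b ≠ c → f a b < f b c → g a b < g b c := by
    intro a ha b hb c hc hab hbc hlt
    have := hstep a b c hb hc hbc
    have := hzero a ha b hb hab
    simp only [g]
    split_ifs <;> grind
  refine ⟨g, fun a ha b hb c hc hab hbc hca => ?_, fun a ha b hb hab => ?_⟩
  · have h1 := hmono a ha b hb c hc hab hbc
    have h2 := hmono b hb c hc a ha hbc hca
    have h3 := hmono c hc a ha b hb hca hab
    have := h a ha b hb c hc hab hbc hca
    unfold TwoCyclic at this ⊢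
    tauto
  · have := hf a ha b hb hab
    have := hlast a b
    have := hzero a ha b hb hab
    simp only [g]
    split_ifs <;> grind

theorem IsCyclicLabelling.card_le {α : Type*} (k : ℕ) (U : Finset α) (f : α → α → ℕ)
    (h : IsCyclicLabelling U f) (hf : ∀ a ∈ U, ∀ b ∈ U, a ≠ b → f a b < k) :
    2 * U.card ≤ 2 + k * (k + 3) := by
  classical
  induction k generalizing U f with
  | zero =>
    have : U.card ≤ 1 := Finset.card_le_one.2 fun a ha b hb => by
      by_contra hab
      exact absurd (hf a ha b hb hab) (by omega)
    omega
  | succ k ih =>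
    obtain ⟨W, hW, hWU, hno⟩ : ∃ W : Finset α, W.card ≤ k + 2 ∧ IsCyclicLabelling (U \ W) f ∧
        ∀ v, ¬ IsRainbowWalk (U \ W) f (k + 1) v := by
      by_cases hv : ∃ v, IsRainbowWalk U f (k + 1) v
      · obtain ⟨v, hv⟩ := hv
        refine ⟨(Finset.range (k + 2)).image v,
          Finset.card_image_le.trans (Finset.card_range _).le,
          h.mono Finset.sdiff_subset, fun w hw => ?_⟩
        refine h.not_disjoint_walks hf hv (w := w) (fun i hi => ?_) fun i hi j hj hij => ?_
        · obtain ⟨h1, h2, h3⟩ := hw i hi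
          exact ⟨(Finset.mem_sdiff.1 h1).1, (Finset.mem_sdiff.1 h2).1, h3⟩
        · have hmem : w j ∈ U \ (Finset.range (k + 2)).image v := by
            rcases j with _ | j
            · exact (hw 0 (by omega)).1
            · exact (hw j (by omega)).2.1
          exact (Finset.mem_sdiff.1 hmem).2
            (Finset.mem_image.2 ⟨i, Finset.mem_range.2 (by omega), hij⟩)
      · exact ⟨∅, by simp, by simpa using h, by simpa using hv⟩
    have hsub : ∀ a ∈ U \ W, a ∈ U := fun a ha => (Finset.mem_sdiff.1 ha).1
    obtain ⟨g, hg, hgk⟩ := hWU.exists_relabel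
      (fun a ha b hb => hf a (hsub a ha) b (hsub b hb)) hno
    have := ih _ g hg hgk
    have := Finset.le_card_sdiff W U
    have : U.card ≤ (U \ W).card + (k + 2) := by omega
    nlinarith

theorem card_filter_forall_eq_zero {α : Type*} [Fintype α] [DecidableEq α] (q : ℕ) [NeZero q]
    (T : Finset α) :
    (Finset.univ.filter fun f : α → Fin q => ∀ x ∈ T, f x = 0).card * q ^ T.card
      = q ^ Fintype.card α := by
  have : (Finset.univ.filter fun f : α → Fin q => ∀ x ∈ T, f x = 0)
      = Fintype.piFinset fun x => if x ∈ T then {0} else Finset.univ := by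
    ext f
    simp only [Finset.mem_filter, Finset.mem_univ, true_and, Fintype.mem_piFinset]
    refine forall_congr' fun x => ?_
    split_ifs <;> simp [*]
  rw [this, Fintype.card_piFinset]
  have : ∀ x, (if x ∈ T then ({0} : Finset (Fin q)) else Finset.univ).card
      = if x ∈ T then 1 else q := fun x => by split_ifs <;> simp
  simp only [this]
  rw [Finset.prod_ite, Finset.prod_const_one, one_mul, Finset.prod_const, ← pow_add,
    ← Finset.compl_filter, Finset.card_compl]
  simp [Nat.sub_add_cancel (Finset.card_le_univ T)]

/-- The deletion method for 3-uniform hypergraphs. -/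
theorem exists_finset_avoiding {α : Type*} [Fintype α] [DecidableEq α] (q : ℕ) [NeZero q]
    (B : Finset (α × α × α)) (hB : ∀ t ∈ B, t.1 ≠ t.2.1 ∧ t.2.1 ≠ t.2.2 ∧ t.2.2 ≠ t.1) :
    ∃ U : Finset α, Fintype.card α * q ^ 2 ≤ q ^ 3 * U.card + B.card ∧
      ∀ t ∈ B, ¬ (t.1 ∈ U ∧ t.2.1 ∈ U ∧ t.2.2 ∈ U) := by
  let A : (α → Fin q) → Finset α := fun f => Finset.univ.filter fun x => f x = 0
  let D : (α → Fin q) → Finset (α × α × α) := fun f =>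
    B.filter fun t => ∀ x ∈ ({t.1, t.2.1, t.2.2} : Finset α), f x = 0
  have hA : (∑ f, (A f).card) * q = Fintype.card α * q ^ Fintype.card α := by
    have : ∑ f, (A f).card = ∑ x, (Finset.univ.filter fun f : α → Fin q => f x = 0).card :=
      Finset.sum_card_bipartiteAbove_eq_sum_card_bipartiteBelow fun (f : α → Fin q) x => f x = 0
    rw [this, Finset.sum_mul, Finset.sum_congr rfl fun x _ => ?_, Finset.sum_const,
      Finset.card_univ, smul_eq_mul]
    simpa using card_filter_forall_eq_zero q {x}
  have hD : (∑ f, (D f).card) * q ^ 3 = B.card * q ^ Fintype.card α := by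
    have : ∑ f, (D f).card = ∑ t ∈ B, (Finset.univ.filter fun f : α → Fin q =>
        ∀ x ∈ ({t.1, t.2.1, t.2.2} : Finset α), f x = 0).card :=
      Finset.sum_card_bipartiteAbove_eq_sum_card_bipartiteBelow
        fun (f : α → Fin q) (t : α × α × α) => ∀ x ∈ ({t.1, t.2.1, t.2.2} : Finset α), f x = 0
    have hT : ∀ t ∈ B, (Finset.univ.filter fun f : α → Fin q =>
        ∀ x ∈ ({t.1, t.2.1, t.2.2} : Finset α), f x = 0).card * q ^ 3
          = q ^ Fintype.card α := fun t ht => by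
      obtain ⟨h1, h2, h3⟩ := hB t ht
      rw [← card_filter_forall_eq_zero q {t.1, t.2.1, t.2.2},
        Finset.card_eq_three.2 ⟨_, _, _, h1, h3.symm, h2, rfl⟩]
    rw [this, Finset.sum_mul, Finset.sum_congr rfl hT, Finset.sum_const, smul_eq_mul]
  obtain ⟨f, -, hf⟩ : ∃ f ∈ (Finset.univ : Finset (α → Fin q)),
      Fintype.card α * q ^ 2 + q ^ 3 * (D f).card ≤ q ^ 3 * (A f).card + B.card := by
    refine Finset.exists_le_of_sum_le Finset.univ_nonempty (le_of_eq ?_)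
    simp only [Finset.sum_add_distrib, ← Finset.mul_sum, Finset.sum_const, Finset.card_univ,
      Fintype.card_fun, Fintype.card_fin, smul_eq_mul]
    rw [mul_comm (q ^ 3) (∑ f, (D f).card), hD,
      show q ^ 3 * ∑ f, (A f).card = (∑ f, (A f).card) * q * q ^ 2 by ring, hA]
    ring
  refine ⟨A f \ (D f).image fun t => t.1, ?_, fun t ht ⟨h1, h2, h3⟩ => ?_⟩
  · have h1 := Finset.le_card_sdiff ((D f).image fun t => t.1) (A f)
    have h2 : ((D f).image fun t => t.1).card ≤ (D f).card := Finset.card_image_le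
    have h3 : (A f).card ≤ (A f \ (D f).image fun t => t.1).card + (D f).card := by omega
    have h4 := Nat.mul_le_mul_left (q ^ 3) h3
    rw [mul_add] at h4
    omega
  · have hmem : ∀ x ∈ A f, f x = 0 := fun x hx => (Finset.mem_filter.1 hx).2
    have h0 : ∀ {x}, x ∈ A f \ (D f).image (fun t => t.1) → f x = 0 :=
      fun hx => hmem _ (Finset.mem_sdiff.1 hx).1
    refine (Finset.mem_sdiff.1 h1).2 (Finset.mem_image.2 ⟨t, Finset.mem_filter.2 ⟨ht, ?_⟩, rfl⟩)
    simp [h0 h1, h0 h2, h0 h3]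

/-- A list read from right to left is a tight path, up to distinctness of its entries. -/
def IsTightList {α : Type*} (R : α → α → α → Prop) (l : List α) : Prop :=
  ∀ i, ∀ h : i + 2 < l.length, R l[i + 2] l[i + 1] l[i]

theorem IsTightList.cons {α : Type*} {R : α → α → α → Prop} {a b c : α} {l : List α}
    (h : IsTightList R (b :: a :: l)) (habc : R a b c) : IsTightList R (c :: b :: a :: l) := by
  rintro (_ | i) hi
  · simpa using habc
  · exact h i (by simpa using hi)

/-- If all tight paths have at most `S` vertices, then some large set of vertices carries a
cyclic labelling by path lengths. -/
theorem exists_isCyclicLabelling {α : Type*} [Fintype α] {R : α → α → α → Prop} {S : ℕ}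
    (hR : ∀ a b c, a ≠ b → b ≠ c → c ≠ a →
      TwoCyclic R a b c ∨ (R a c b ∧ R c b a ∧ R b a c))
    (hS : ∀ l : List α, l.Nodup → IsTightList R l → l.length ≤ S) (q : ℕ) [NeZero q] :
    ∃ (U : Finset α) (f : α → α → ℕ),
      Fintype.card α * q ^ 2 ≤ q ^ 3 * U.card + Fintype.card α ^ 2 * S ∧
      IsCyclicLabelling U f ∧ ∀ a ∈ U, ∀ b ∈ U, a ≠ b → f a b < S - 1 := by
  classical
  have hP : ∀ a b : α, ∃ l : List α, a ≠ b →
      ((b :: a :: l).Nodup ∧ IsTightList R (b :: a :: l)) ∧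
      ∀ l' : List α, (b :: a :: l').Nodup → IsTightList R (b :: a :: l') →
        l'.length ≤ l.length := by
    intro a b
    by_cases hab : a = b
    · exact ⟨[], fun h => absurd hab h⟩
    let X : Set ℕ := {m | ∃ l : List α, l.length = m ∧ (b :: a :: l).Nodup ∧
      IsTightList R (b :: a :: l)}
    have hne : X.Nonempty := ⟨0, [], rfl, by simpa using Ne.symm hab, fun i hi => by simp at hi⟩
    have hbdd : BddAbove X := ⟨S, by
      rintro m ⟨l, rfl, h1, h2⟩
      have := hS _ h1 h2
      simp only [List.length_cons] at this
      omega⟩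
    obtain ⟨l, hl, h1, h2⟩ := Nat.sSup_mem hne hbdd
    exact ⟨l, fun _ => ⟨⟨h1, h2⟩, fun l' h1' h2' => hl ▸ le_csSup hbdd ⟨l', rfl, h1', h2'⟩⟩⟩
  choose P hP using hP
  let B : Finset (α × α × α) := Finset.univ.filter fun t =>
    (t.1 ≠ t.2.1 ∧ t.2.1 ≠ t.2.2 ∧ t.2.2 ≠ t.1) ∧ t.2.2 ∈ P t.1 t.2.1
  have hB : B.card ≤ Fintype.card α ^ 2 * S := by
    have hfib : ∀ a b : α, (∑ c : α, if (a ≠ b ∧ b ≠ c ∧ c ≠ a) ∧ c ∈ P a b then 1 else 0) ≤ S := by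
      intro a b
      rw [← Finset.card_filter]
      by_cases hab : a = b
      · simp [hab]
      · have hlen := hS _ (hP a b hab).1.1 (hP a b hab).1.2
        simp only [List.length_cons] at hlen
        have hsub : (Finset.univ.filter fun c : α => (a ≠ b ∧ b ≠ c ∧ c ≠ a) ∧ c ∈ P a b)
            ⊆ (P a b).toFinset := fun c hc => List.mem_toFinset.2 (Finset.mem_filter.1 hc).2.2
        have := Finset.card_le_card hsub
        have := List.toFinset_card_le (P a b)
        omega
    rw [Finset.card_filter, Fintype.sum_prod_type]
    simp only [Fintype.sum_prod_type]
    calc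
      _ ≤ ∑ _a : α, ∑ _b : α, S :=
        Finset.sum_le_sum fun a _ => Finset.sum_le_sum fun b _ => hfib a b
      _ = _ := by simp [sq, mul_assoc]
  obtain ⟨U, hU, hUB⟩ := exists_finset_avoiding q B fun t ht => (Finset.mem_filter.1 ht).2.1
  have hmono : ∀ a ∈ U, ∀ b ∈ U, ∀ c ∈ U, a ≠ b → b ≠ c → c ≠ a → R a b c →
      (P a b).length < (P b c).length := by
    intro a ha b hb c hc hab hbc hca habc
    have hcP : c ∉ P a b := fun hcP =>
      hUB (a, b, c) (Finset.mem_filter.2 ⟨Finset.mem_univ _, ⟨hab, hbc, hca⟩, hcP⟩) ⟨ha, hb, hc⟩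
    obtain ⟨⟨h1, h2⟩, -⟩ := hP a b hab
    exact (hP b c hbc).2 (a :: P a b) (List.nodup_cons.2 ⟨by simp [hbc.symm, hca, hcP], h1⟩)
      (h2.cons habc)
  refine ⟨U, fun a b => (P a b).length, hU.trans (by omega), ?_, ?_⟩
  · intro a ha b hb c hc hab hbc hca
    have h1 := hmono a ha b hb c hc hab hbc hca
    have h2 := hmono b hb c hc a ha hbc hca hab
    have h3 := hmono c hc a ha b hb hca hab hbc
    have g1 := hmono a ha c hc b hb hca.symm hbc.symm hab.symm
    have g2 := hmono c hc b hb a ha hbc.symm hab.symm hca.symm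
    have g3 := hmono b hb a ha c hc hab.symm hca.symm hbc.symm
    have := hR a b c hab hbc hca
    unfold TwoCyclic at this ⊢
    rcases this with this | ⟨r1, r2, r3⟩
    · tauto
    · have := g1 r1
      have := g2 r2
      have := g3 r3
      omega
  · intro a _ b _ hab
    have := hS _ (hP a b hab).1.1 (hP a b hab).1.2
    simp only [List.length_cons] at this
    change (P a b).length < S - 1
    omega

/-- A structure on `n ≥ 3 S⁵` vertices contains a tight path on more than `S` vertices. -/
theorem exists_long_tightList {α : Type*} [Fintype α] {R : α → α → α → Prop} {S : ℕ}
    (hR : ∀ a b c, a ≠ b → b ≠ c → c ≠ a →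
      TwoCyclic R a b c ∨ (R a c b ∧ R c b a ∧ R b a c)) (hS : 4 ≤ S)
    (h1 : 3 * S ^ 5 ≤ Fintype.card α) (h2 : Fintype.card α ≤ 6 * S ^ 5) :
    ∃ l : List α, l.Nodup ∧ IsTightList R l ∧ S < l.length := by
  by_contra! hno
  have : NeZero (3 * S ^ 3) := ⟨by positivity⟩
  obtain ⟨U, f, hU, hf, hfS⟩ := exists_isCyclicLabelling hR hno (3 * S ^ 3)
  have hcard := hf.card_le _ _ _ hfS
  obtain ⟨K, rfl⟩ : ∃ K, S = K + 1 := ⟨S - 1, by omega⟩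
  simp only [Nat.add_sub_cancel] at hcard
  set n := Fintype.card α
  set S := K + 1 with hSK
  have hc : 2 * U.card ≤ S ^ 2 + S := by rw [hSK]; nlinarith
  -- `n (9 S⁶ - n S) ≥ 18 S¹¹` for `3 S⁵ ≤ n ≤ 6 S⁵`
  have hn : 18 * S ^ 11 + n ^ 2 * S ≤ n * (3 * S ^ 3) ^ 2 := by
    obtain ⟨d, hd⟩ := Nat.exists_eq_add_of_le h1
    obtain ⟨d', hd'⟩ := Nat.exists_eq_add_of_le h2
    have : d + d' = 3 * S ^ 5 := by omega
    have hdd : n * (3 * S ^ 3) ^ 2 = 18 * S ^ 11 + n ^ 2 * S + d * d' * S := by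
      have h9 : (3 * S ^ 3) ^ 2 = 3 * S * (d + d') := by rw [this]; ring
      have h18 : 18 * S ^ 11 = 2 * S * (d + d') ^ 2 := by rw [this]; ring
      rw [h9, h18, hd, ← this]
      ring
    omega
  have h3 : 18 * S ^ 11 ≤ (3 * S ^ 3) ^ 3 * U.card := by omega
  have h4 : S ^ 9 * (2 * S ^ 2) ≤ S ^ 9 * (3 * U.card) := by nlinarith
  have h5 := Nat.le_of_mul_le_mul_left h4 (by positivity)
  nlinarith

theorem IsRKTournament.twoCyclic_or {n : ℕ} {E : Set (Fin 3 → Fin n)}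
    (hE : IsRKTournament 3 4 n E) (a b c : Fin n) (hab : a ≠ b) (hbc : b ≠ c) (hca : c ≠ a) :
    TwoCyclic (fun x y z => ![x, y, z] ∈ E) a b c ∨
      (![a, c, b] ∈ E ∧ ![c, b, a] ∈ E ∧ ![b, a, c] ∈ E) := by
  classical
  let l : List (Fin 3 → Fin n) :=
    [![a, b, c], ![b, c, a], ![c, a, b], ![a, c, b], ![c, b, a], ![b, a, c]]
  have hsub : {e | e ∈ E ∧ ∀ i, e i ∈ ({a, b, c} : Finset (Fin n))}
      ⊆ (l.filter (· ∈ E)).toFinset := by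
    rintro e ⟨he, hi⟩
    have hinj := hE.1 e he
    have h01 : e 0 ≠ e 1 := fun h => absurd (hinj h) (by decide)
    have h12 : e 1 ≠ e 2 := fun h => absurd (hinj h) (by decide)
    have h02 : e 0 ≠ e 2 := fun h => absurd (hinj h) (by decide)
    have hee : e = ![e 0, e 1, e 2] := by
      ext i
      fin_cases i <;> rfl
    have h0 := hi 0
    have h1 := hi 1
    have h2 := hi 2
    simp only [Finset.mem_insert, Finset.mem_singleton] at h0 h1 h2
    simp only [List.coe_toFinset, List.mem_filter, decide_eq_true_eq]
    refine ⟨?_, he⟩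
    rw [hee]
    rcases h0 with h0 | h0 | h0 <;> rcases h1 with h1 | h1 | h1 <;>
      rcases h2 with h2 | h2 | h2 <;>
      first
      | exact absurd (h0.trans h1.symm) h01
      | exact absurd (h1.trans h2.symm) h12
      | exact absurd (h0.trans h2.symm) h02
      | (rw [h0, h1, h2]; simp [l])
  have h4 := hE.2 {a, b, c} (Finset.card_eq_three.2 ⟨a, b, c, hab, hca.symm, hbc, rfl⟩)
  have hle := Set.ncard_le_ncard hsub (Finset.finite_toSet _)
  rw [h4, Set.ncard_coe_finset] at hle
  have hlen := hle.trans (List.toFinset_card_le _)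
  rw [← List.countP_eq_length_filter] at hlen
  simp only [l, List.countP_cons, List.countP_nil, decide_eq_true_eq] at hlen
  unfold TwoCyclic
  by_contra hcon
  split_ifs at hlen <;> first | omega | tauto

theorem hasTightPath_of_isTightList {n s : ℕ} {E : Set (Fin 3 → Fin n)} {l : List (Fin n)}
    (hnd : l.Nodup) (hl : IsTightList (fun x y z => ![x, y, z] ∈ E) l) (hs : s ≤ l.length) :
    HasTightPath 3 E s := by
  refine ⟨fun j => l[s - 1 - j.1]'(by omega), fun i j hij => ?_, fun j hj => ?_⟩
  · have := (hnd.getElem_inj_iff).1 hij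
    ext
    omega
  · convert hl (s - 3 - j) (by omega) using 1
    ext i
    fin_cases i <;> simp <;> congr 2 <;> omega

/-- Theorem: for every `ε > 0`, every sufficiently large `n`-vertex
`(3,4)`-tournament contains a tight path on at least `(1−ε)·(n/3)^{1/5}` vertices. -/
theorem stmt17 (ε : ℝ) (hε : 0 < ε) :
    ∃ n₀ : ℕ, ∀ n : ℕ, n₀ ≤ n →
      ∀ E : Set (Fin 3 → Fin n), IsRKTournament 3 4 n E →
        ∃ s : ℕ, (1 - ε) * (((n : ℝ) / 3) ^ ((1 : ℝ) / 5)) ≤ (s : ℝ) ∧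
          HasTightPath 3 E s := by
  refine ⟨3 * 10 ^ 5, fun n hn E hE => ?_⟩
  set x : ℝ := ((n : ℝ) / 3) ^ ((1 : ℝ) / 5) with hx
  have hx0 : 0 ≤ x := by positivity
  have hx5 : 3 * x ^ 5 = n := by
    rw [hx, ← Real.rpow_natCast, ← Real.rpow_mul (by positivity)]
    norm_num
    ring
  have hle : (⌊x⌋₊ : ℝ) ≤ x := Nat.floor_le hx0
  have hlt : x < (⌊x⌋₊ : ℝ) + 1 := Nat.lt_floor_add_one x
  have h1 : 3 * ⌊x⌋₊ ^ 5 ≤ n := by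
    have : (3 * ⌊x⌋₊ ^ 5 : ℝ) ≤ n := by rw [← hx5]; gcongr
    exact_mod_cast this
  have h3 : n < 3 * (⌊x⌋₊ + 1) ^ 5 := by
    have : (n : ℝ) < 3 * (⌊x⌋₊ + 1) ^ 5 := by rw [← hx5]; gcongr
    exact_mod_cast this
  have hS : 9 ≤ ⌊x⌋₊ := by
    by_contra! h
    have : (⌊x⌋₊ + 1) ^ 5 ≤ 10 ^ 5 := Nat.pow_le_pow_left (by omega) 5
    omega
  have h2 : n ≤ 6 * ⌊x⌋₊ ^ 5 := by
    have : (⌊x⌋₊ + 1) ^ 5 ≤ 2 * ⌊x⌋₊ ^ 5 := by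
      obtain ⟨d, hd⟩ := Nat.exists_eq_add_of_le hS
      rw [hd]
      ring_nf
      nlinarith [sq_nonneg d, pow_nonneg (Nat.zero_le d) 3, pow_nonneg (Nat.zero_le d) 4,
        pow_nonneg (Nat.zero_le d) 5]
    omega
  obtain ⟨l, hnd, hl, hlen⟩ := exists_long_tightList (α := Fin n) (S := ⌊x⌋₊) hE.twoCyclic_or
    (by omega) (by simpa using h1) (by simpa using h2)
  refine ⟨⌊x⌋₊ + 1, ?_, hasTightPath_of_isTightList hnd hl hlen⟩
  push_cast
  nlinarith
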